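/- For every rc-graph R satisfying condition (*) and every integer 1 ≤ k ≤ n, the insertion R ← k is again an rc-graph; it has the same number of crossings as R in every row except row k, where it has exactly one more crossing; consequently x^{R←k} = x^R · x_k. -/

import Mathlib

open scoped Classical

noncomputable section

namespace RCGraphs

/-- The simple transposition `s j`, interchanging `j` and `j+1`. -/
def sT (j : ℤ) : Equiv.Perm ℤ := Equiv.swap j (j + 1)

/-- The Coxeter length of a permutation of `ℤ`: the minimal length of an expression
as a product of simple transpositions. -/
def len (w : Equiv.Perm ℤ) : ℕ :=
  sInf {m : ℕ | ∃ l : List ℤ, l.length = m ∧ (l.map sT).prod = w}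

/-- The permutations considered in the paper: bijections of `ℤ` fixing every `i > n`
and fixing all sufficiently small integers. -/
def IsPermZ (n : ℤ) (w : Equiv.Perm ℤ) : Prop :=
  (∀ i : ℤ, n < i → w i = i) ∧ ∃ N : ℤ, ∀ i : ℤ, i < N → w i = i

/-- The reading order on positions `(i,k)`: rows (second coordinate) from `n` downward,
and within a row in order of increasing first coordinate. -/
def rcOrder (p q : ℤ × ℤ) : Prop :=
  q.2 < p.2 ∨ (p.2 = q.2 ∧ p.1 ≤ q.1)

instance : DecidableRel rcOrder := fun p q => by
  unfold rcOrder; infer_instance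

instance : IsTrans (ℤ × ℤ) rcOrder :=
  ⟨fun a b c h₁ h₂ => by unfold rcOrder at *; omega⟩

instance : IsAntisymm (ℤ × ℤ) rcOrder :=
  ⟨fun a b h₁ h₂ => by
    unfold rcOrder at *
    have h3 : a.1 = b.1 ∧ a.2 = b.2 := by omega
    exact Prod.ext h3.1 h3.2⟩

instance : IsTotal (ℤ × ℤ) rcOrder :=
  ⟨fun a b => by unfold rcOrder; omega⟩

/-- The permutation `w_R` associated to a finite set of positions `R`: the product of the
simple transpositions `s_{i+k-n-1}`, `(i,k) ∈ R`, in the reading order. -/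
def wR (n : ℤ) (R : Finset (ℤ × ℤ)) : Equiv.Perm ℤ :=
  ((R.sort rcOrder).map fun p => sT (p.1 + p.2 - n - 1)).prod

/-- `R` is an rc-graph: positions lie in the grid `{(i,k) : i ≤ n, k ≤ n}` and the
reading word is reduced. -/
def IsRC (n : ℤ) (R : Finset (ℤ × ℤ)) : Prop :=
  (∀ p ∈ R, p.1 ≤ n ∧ p.2 ≤ n) ∧ len (wR n R) = R.card

/-- Condition (*): `w_R(i) > w_R(i-1)` for all `i ≤ 0`; equivalently no two strands with
nonpositive labels cross. -/
def Star (n : ℤ) (R : Finset (ℤ × ℤ)) : Prop :=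
  ∀ i : ℤ, i ≤ 0 → wR n R (i - 1) < wR n R i

/-- Strand labels in the wiring diagram of `R` (for diagrams all of whose crossings lie in
rows `k ≥ 1`, as is the case under condition (*)).  `lab n R true i k` is the label of the
strand entering position `(i,k)` from the west (the strand passing above, if `(i,k)` is not
a crossing); `lab n R false i k` is the label of the strand entering from the south (the
strand passing below).  Each strand is labeled by the row where it begins. -/
def lab (n : ℤ) (R : Finset (ℤ × ℤ)) : Bool → ℤ → ℤ → ℤ
  | true, i, k =>
      if h : n ≤ i then k
      else if (i + 1, k) ∈ R then lab n R true (i + 1) k else lab n R false (i + 1) k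
  | false, i, k =>
      if h : k ≤ 0 then i + k - n - 1
      else if (i, k - 1) ∈ R then lab n R false i (k - 1) else lab n R true i (k - 1)
  termination_by b i k => ((n - i).toNat + k.toNat)
  decreasing_by
    all_goals simp_wf
    all_goals omega

/-- The label of the strand leaving position `(i,r)` northward. -/
def northLabel (n : ℤ) (R : Finset (ℤ × ℤ)) (i r : ℤ) : ℤ :=
  if (i, r) ∈ R then lab n R false i r else lab n R true i r

/-- `(i,k)` is an open space: not a crossing, the strand passing below it has a
nonpositive label and the strand passing above it has a positive label. -/
def OpenSpace (n : ℤ) (R : Finset (ℤ × ℤ)) (i k : ℤ) : Prop :=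
  i ≤ n ∧ (i, k) ∉ R ∧ lab n R false i k ≤ 0 ∧ 0 < lab n R true i k

/-- The main loop of the Bergeron--Billey insertion algorithm, recording the trace:
the list of pairs (current diagram, crossing just added).  `R` always contains the
crossing `p` that was just added. -/
def insertSteps (n : ℤ) : ℕ → Finset (ℤ × ℤ) → ℤ × ℤ → List (Finset (ℤ × ℤ) × (ℤ × ℤ))
  | 0, _, _ => []
  | fuel + 1, R, p =>
      (R, p) ::
        if IsRC n R then []
        else
          let a := lab n R true p.1 p.2
          let b := lab n R false p.1 p.2
          -- the unique other crossing of the two strands that cross at `p`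
          let C := R.filter fun q =>
            q ≠ p ∧ ((lab n R true q.1 q.2 = a ∧ lab n R false q.1 q.2 = b) ∨
                     (lab n R true q.1 q.2 = b ∧ lab n R false q.1 q.2 = a))
          let q := (C.sort rcOrder).headI
          let R' := R.erase q
          let i' := sInf {x : ℤ | q.1 < x ∧ OpenSpace n R' x q.2}
          insertSteps n fuel (insert (i', q.2) R') (i', q.2)

/-- The trace of the insertion of `k` into `R`: the states of the algorithm together with
the crossings added at each step. -/
def insertStepsOf (n : ℤ) (R : Finset (ℤ × ℤ)) (k : ℤ) : List (Finset (ℤ × ℤ) × (ℤ × ℤ)) :=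
  let i₁ := sInf {x : ℤ | OpenSpace n R x k}
  insertSteps n ((n + 1 - k).toNat + 1) (insert (i₁, k) R) (i₁, k)

/-- The insertion `R ← k` of Bergeron and Billey. -/
def insertOne (n : ℤ) (R : Finset (ℤ × ℤ)) (k : ℤ) : Finset (ℤ × ℤ) :=
  ((insertStepsOf n R k).getLast?.getD (R, (0, 0))).1

/-- The insertion `R ← v` of a word. -/
def insertWord (n : ℤ) (R : Finset (ℤ × ℤ)) (v : List ℕ) : Finset (ℤ × ℤ) :=
  v.foldl (fun S a => insertOne n S (a : ℤ)) R

/-- The column (first coordinate) at which the strand labeled `a` of the diagram `R`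
leaves row `r` northward. -/
def strandCol (n : ℤ) (R : Finset (ℤ × ℤ)) (a r : ℤ) : ℤ :=
  sSup {i : ℤ | i ≤ n ∧ northLabel n R i r = a}

/-- Given the trace `L` of an insertion, the column occupied in row `r` by the left path
(`left = true`) or the right path (`left = false`) of the insertion.  Between the rows of
the `t`-th and `(t+1)`-st added crossings, the left path is the piece `s_t` of the strand
whose label changes from `a_t` to `b_t`, and the right path is the piece `s^t` whose label
changes from `b_t` to `a_t`. -/
def pathCol (n : ℤ) (L : List (Finset (ℤ × ℤ) × (ℤ × ℤ))) (left : Bool) (r : ℤ) : ℤ :=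
  match (L.filter fun e => e.2.2 ≤ r).getLast? with
  | some e => strandCol n e.1 (lab n e.1 left e.2.1 e.2.2) r
  | none => 0

/-- A semistandard Young tableau with at most `n` rows (rows indexed `1,…,n`, row `j`
having `μ j` boxes, columns indexed from `0`), with entries in `{1,…,n}`, weakly
increasing along rows and strictly increasing down columns; entries outside the shape
are `0`. -/
structure SSYT (n : ℕ) (μ : ℕ → ℕ) where
  entry : ℕ → ℕ → ℕ
  entry_mem : ∀ j c, 1 ≤ j → j ≤ n → c < μ j → 1 ≤ entry j c ∧ entry j c ≤ n
  row_weak : ∀ j c₁ c₂, 1 ≤ j → j ≤ n → c₁ ≤ c₂ → c₂ < μ j → entry j c₁ ≤ entry j c₂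
  col_strict : ∀ j₁ j₂ c, 1 ≤ j₁ → j₁ < j₂ → j₂ ≤ n → c < μ j₂ → entry j₁ c < entry j₂ c
  outside : ∀ j c, j = 0 ∨ n < j ∨ μ j ≤ c → entry j c = 0

/-- `μ` is a partition with (at most) `n` parts `μ 1 ≥ μ 2 ≥ … ≥ μ n ≥ 0`
(and `μ j = 0` outside `1,…,n`). -/
def IsPartition (n : ℕ) (μ : ℕ → ℕ) : Prop :=
  (∀ j, 1 ≤ j → j < n → μ (j + 1) ≤ μ j) ∧ ∀ j, j = 0 ∨ n < j → μ j = 0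

/-- The reading word of a tableau: the rows read left to right, from the bottom row
to the top one. -/
def readingWord (n : ℕ) (μ : ℕ → ℕ) (Y : SSYT n μ) : List ℕ :=
  ((List.range n).reverse.map (· + 1)).flatMap fun j =>
    (List.range (μ j)).map fun c => Y.entry j c

/-- An elementary Knuth move. -/
def KnuthMove (w₁ w₂ : List ℕ) : Prop :=
  (∃ (u v : List ℕ) (x y z : ℕ), x < y ∧ y ≤ z ∧
      w₁ = u ++ y :: x :: z :: v ∧ w₂ = u ++ y :: z :: x :: v) ∨
  (∃ (u v : List ℕ) (x y z : ℕ), x ≤ y ∧ y < z ∧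
      w₁ = u ++ x :: z :: y :: v ∧ w₂ = u ++ z :: x :: y :: v)

/-- Knuth equivalence: the equivalence relation generated by elementary Knuth moves. -/
def KnuthEquiv (w₁ w₂ : List ℕ) : Prop := Relation.EqvGen KnuthMove w₁ w₂

/-- The monomial `x^R = ∏_{(i,k) ∈ R} x_k`. -/
def xR (R : Finset (ℤ × ℤ)) : MvPolynomial ℕ ℤ :=
  ∏ p ∈ R, MvPolynomial.X p.2.toNat

/-- The monomial `x^Y = ∏ x_i`, one factor for each entry `i` of `Y`. -/
def xY (n : ℕ) (μ : ℕ → ℕ) (Y : SSYT n μ) : MvPolynomial ℕ ℤ :=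
  ((readingWord n μ Y).map MvPolynomial.X).prod

/-- The Schubert polynomial `S_w = Σ_{R : w_R = w} x^R`. -/
def Schub (n : ℤ) (w : Equiv.Perm ℤ) : MvPolynomial ℕ ℤ :=
  ∑ᶠ R ∈ {R : Finset (ℤ × ℤ) | IsRC n R ∧ wR n R = w}, xR R

/-- The Schur polynomial `s_μ(x₁,…,x_n) = Σ_Y x^Y`, summing over all semistandard Young
tableaux of shape `μ` with entries in `{1,…,n}`. -/
def SchurP (n : ℕ) (μ : ℕ → ℕ) : MvPolynomial ℕ ℤ :=
  ∑ᶠ Y : SSYT n μ, xY n μ Y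

/-- The complete homogeneous symmetric polynomial
`h_m = Σ_{1 ≤ i₁ ≤ … ≤ i_m ≤ n} x_{i₁} ⋯ x_{i_m}`. -/
def hPoly (n m : ℕ) : MvPolynomial ℕ ℤ :=
  ∑ s ∈ (Finset.Icc 1 n).sym m, (s.1.map MvPolynomial.X).prod

/-- The top rc-graph `R(μ) = {(i,k) : 1 ≤ k ≤ n, n - μ_k + 1 ≤ i ≤ n}` of a partition. -/
def Rmu (n : ℕ) (μ : ℕ → ℕ) : Finset (ℤ × ℤ) :=
  (Finset.Icc 1 (n : ℤ)).biUnion fun k =>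
    (Finset.Icc ((n : ℤ) - μ k.toNat + 1) (n : ℤ)).image fun i => (i, k)


/-- The product of the simple transpositions of a word. -/
def W (l : List ℤ) : Equiv.Perm ℤ := (l.map sT).prod

/-- A word is reduced in the strand-crossing sense: read from the right,
each letter crosses two strands that are not yet inverted. -/
def Red : List ℤ → Prop
  | [] => True
  | j :: v => Red v ∧ (W v)⁻¹ j < (W v)⁻¹ (j + 1)

/-- The inversions of a permutation. -/
def invs (w : Equiv.Perm ℤ) : Set (ℤ × ℤ) := {x | x.1 < x.2 ∧ w x.2 < w x.1}

lemma W_nil : W [] = 1 := rfl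

lemma W_cons (j : ℤ) (v : List ℤ) : W (j :: v) = sT j * W v := by simp [W]

lemma W_append (u v : List ℤ) : W (u ++ v) = W u * W v := by simp [W]

lemma sT_apply (j y : ℤ) : sT j y = if y = j then j + 1 else if y = j + 1 then j else y := by
  simp [sT, Equiv.swap_apply_def]

lemma sT_mul_self (j : ℤ) : sT j * sT j = 1 := by
  simp [sT]

lemma sT_inv (j : ℤ) : (sT j)⁻¹ = sT j := by
  simp [sT]

lemma invs_step (w : Equiv.Perm ℤ) (j : ℤ) (h : w⁻¹ j < w⁻¹ (j + 1)) :
    invs (sT j * w) = insert (w⁻¹ j, w⁻¹ (j + 1)) (invs w) := by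
  ext ⟨x, y⟩
  have e1 : ∀ z a, z = w⁻¹ a ↔ w z = a := by
    intro z a; rw [Equiv.Perm.eq_inv_iff_eq]
  have inj : w x = w y → x = y := fun h => w.injective h
  simp only [invs, Set.mem_ofPred_eq, Set.mem_insert_iff, Prod.mk.injEq, e1, Equiv.Perm.mul_apply,
    sT_apply]
  have hx : w x = j + 1 → x = w⁻¹ (j + 1) := fun h => (e1 _ _).2 h
  have hy : w y = j → y = w⁻¹ j := fun h => (e1 _ _).2 h
  have hx' : w x = j → x = w⁻¹ j := fun h => (e1 _ _).2 h
  have hy' : w y = j + 1 → y = w⁻¹ (j + 1) := fun h => (e1 _ _).2 h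
  constructor
  · rintro ⟨h1, h2⟩
    split_ifs at h2 <;> grind
  · rintro (⟨h1, h2⟩ | ⟨h1, h2⟩)
    · have := hx' h1
      have := hy' h2
      refine ⟨by omega, ?_⟩
      simp [h1, h2]
    · refine ⟨h1, ?_⟩
      split_ifs <;> grind

lemma encard_step (w : Equiv.Perm ℤ) (j : ℤ) :
    (invs (sT j * w)).encard ≤ (invs w).encard + 1 := by
  rcases lt_trichotomy (w⁻¹ j) (w⁻¹ (j + 1)) with h | h | h
  · rw [invs_step w j h]; exact Set.encard_insert_le _ _
  · have := w⁻¹.injective h; omega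
  · have h2 := invs_step (sT j * w) j (by
      simpa [mul_inv_rev, sT_inv, Equiv.Perm.mul_apply, sT_apply] using h)
    rw [← mul_assoc, sT_mul_self, one_mul] at h2
    rw [h2]
    exact (Set.encard_le_encard (Set.subset_insert _ _)).trans le_self_add

lemma card_le (l : List ℤ) : (invs (W l)).encard ≤ l.length := by
  induction l with
  | nil =>
    have : invs (W []) = ∅ := by
      ext x; simp [invs, W_nil]; intro h; omega
    simp [this]
  | cons j v ih =>
    rw [W_cons]
    refine (encard_step _ _).trans ?_
    push_cast [List.length_cons]
    gcongr

lemma red_card (l : List ℤ) (hl : Red l) : (invs (W l)).encard = l.length := by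
  induction l with
  | nil =>
    have : invs (W []) = ∅ := by
      ext x; simp [invs, W_nil]; intro h; omega
    simp [this]
  | cons j v ih =>
    obtain ⟨h1, h2⟩ := hl
    rw [W_cons, invs_step _ _ h2, Set.encard_insert_of_notMem, ih h1]
    · simp
    · simp [invs]

lemma len_le (l : List ℤ) : len (W l) ≤ l.length := Nat.sInf_le ⟨l, rfl, rfl⟩

lemma red_len (l : List ℤ) (hl : Red l) : len (W l) = l.length := by
  apply le_antisymm (len_le l)
  obtain ⟨l', h1, h2⟩ := Nat.sInf_mem (s := {m : ℕ | ∃ l' : List ℤ, l'.length = m ∧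
    (l'.map sT).prod = W l}) ⟨_, l, rfl, rfl⟩
  have h3 := card_le l'
  have h4 : W l' = W l := h2
  rw [h4, red_card l hl, h1] at h3
  exact_mod_cast h3

lemma exchange (v : List ℤ) (x y : ℤ) (hxy : x < y) (h : W v y < W v x) :
    ∃ v1 m v2, v = v1 ++ m :: v2 ∧ W v2 x = m ∧ W v2 y = m + 1 := by
  induction v with
  | nil => simp [W_nil] at h; omega
  | cons m v ih =>
    by_cases h2 : W v y < W v x
    · obtain ⟨v1, m', v2, h3, h4⟩ := ih h2
      exact ⟨m :: v1, m', v2, by simp [h3], h4⟩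
    · refine ⟨[], m, v, rfl, ?_⟩
      have : W v x ≠ W v y := fun h => by have := (W v).injective h; omega
      rw [W_cons] at h
      simp only [Equiv.Perm.mul_apply, sT_apply] at h
      split_ifs at h <;> omega

lemma not_red_len (l : List ℤ) (hl : ¬ Red l) : ∃ l', W l' = W l ∧ l'.length < l.length := by
  induction l with
  | nil => exact absurd trivial hl
  | cons j v ih =>
    by_cases hv : Red v
    · have h1 : (W v)⁻¹ (j + 1) < (W v)⁻¹ j := by
        have h2 : ¬ (W v)⁻¹ j < (W v)⁻¹ (j + 1) := fun h => hl ⟨hv, h⟩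
        have h3 : (W v)⁻¹ j ≠ (W v)⁻¹ (j + 1) := fun h => by
          have := (W v)⁻¹.injective h; omega
        omega
      obtain ⟨v1, m, v2, h2, h3, h4⟩ := exchange v _ _ h1 (by simp)
      refine ⟨v1 ++ v2, ?_, by simp [h2]⟩
      have e1 : W v = W v1 * sT m * W v2 := by rw [h2, W_append, W_cons, mul_assoc]
      have h5 : (W v)⁻¹ (j + 1) = (W v2)⁻¹ m := by rw [Equiv.Perm.eq_inv_iff_eq]; exact h3
      have h6 : (W v)⁻¹ j = (W v2)⁻¹ (m + 1) := by rw [Equiv.Perm.eq_inv_iff_eq]; exact h4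
      have h7 : sT j * W v = W v * (Equiv.swap ((W v)⁻¹ j) ((W v)⁻¹ (j + 1))) := by
        rw [Equiv.mul_swap_eq_swap_mul]; simp [sT]
      rw [W_cons, h7, h5, h6, e1, W_append, Equiv.swap_comm, mul_assoc,
        Equiv.mul_swap_eq_swap_mul]
      simp [sT, ← mul_assoc]
    · obtain ⟨l', h1, h2⟩ := ih hv
      exact ⟨j :: l', by rw [W_cons, W_cons, h1], by simpa using h2⟩

lemma red_iff (l : List ℤ) : Red l ↔ len (W l) = l.length := by
  refine ⟨red_len l, fun h => ?_⟩
  by_contra hl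
  obtain ⟨l', h1, h2⟩ := not_red_len l hl
  have := len_le l'
  rw [h1] at this
  omega

lemma red_suffix (u v : List ℤ) (h : Red (u ++ v)) : Red v := by
  induction u with
  | nil => exact h
  | cons j u ih => exact ih h.1

lemma inv_mono (u v : List ℤ) (h : Red (u ++ v)) (x y : ℤ) (hxy : x < y)
    (hv : W v y < W v x) : W (u ++ v) y < W (u ++ v) x := by
  induction u with
  | nil => exact hv
  | cons j u ih =>
    have h1 := ih h.1
    have h2 : (W (u ++ v))⁻¹ j < (W (u ++ v))⁻¹ (j + 1) := h.2
    rw [List.cons_append, W_cons]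
    set w := W (u ++ v)
    have hy : w y = j → y = w⁻¹ j := fun h => by rw [Equiv.Perm.eq_inv_iff_eq]; exact h
    have hx : w x = j + 1 → x = w⁻¹ (j + 1) := fun h => by
      rw [Equiv.Perm.eq_inv_iff_eq]; exact h
    simp only [Equiv.Perm.mul_apply, sT_apply]
    split_ifs <;> grind

lemma cross_unique (e g h : List ℤ) (m k : ℤ) (hr : Red (e ++ m :: (g ++ k :: h)))
    (hh : ((W (g ++ k :: h))⁻¹ m = (W h)⁻¹ k ∧ (W (g ++ k :: h))⁻¹ (m + 1) = (W h)⁻¹ (k + 1)) ∨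
      ((W (g ++ k :: h))⁻¹ m = (W h)⁻¹ (k + 1) ∧ (W (g ++ k :: h))⁻¹ (m + 1) = (W h)⁻¹ k)) :
    False := by
  have h1 := red_suffix _ _ hr
  have h2 := h1.2
  have h3 := h1.1
  have h4 := (red_suffix _ _ h3).2
  have h5 := inv_mono _ _ h3 _ _ h4 (by simp [W_cons, sT_apply])
  rcases hh with ⟨a, b⟩ | ⟨a, b⟩
  · rw [← a, ← b] at h5
    simp at h5
  · omega

lemma first_fail (u x : List ℤ) (hx : Red x) (h : ¬ Red (u ++ x)) :
    ∃ u1 t u2, u = u1 ++ t :: u2 ∧ Red (u2 ++ x) ∧ ¬ Red (t :: (u2 ++ x)) := by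
  induction u with
  | nil => exact absurd hx h
  | cons j u ih =>
    by_cases h1 : Red (u ++ x)
    · exact ⟨[], j, u, rfl, h1, h⟩
    · obtain ⟨u1, t, u2, h2, h3⟩ := ih h1
      exact ⟨j :: u1, t, u2, by simp [h2], h3⟩

/-- Inserting one crossing between two strands that have not crossed yet into a reduced word:
if the result is not reduced, there is a letter crossing the same two strands again. -/
lemma key (u v : List ℤ) (s : ℤ) (hr : Red (u ++ v)) (hs : (W v)⁻¹ s < (W v)⁻¹ (s + 1))
    (hn : ¬ Red (u ++ s :: v)) :
    ∃ u1 t u2, u = u1 ++ t :: u2 ∧ Red (u2 ++ s :: v) ∧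
      sT t * W (u2 ++ v) = W (u2 ++ s :: v) ∧
      (W (u2 ++ v))⁻¹ t = (W v)⁻¹ s ∧ (W (u2 ++ v))⁻¹ (t + 1) = (W v)⁻¹ (s + 1) := by
  have hv := red_suffix _ _ hr
  obtain ⟨u1, t, u2, h1, h2, h3⟩ := first_fail u (s :: v) ⟨hv, hs⟩ hn
  refine ⟨u1, t, u2, h1, h2, ?_⟩
  have hy : Red (t :: (u2 ++ v)) := by
    apply red_suffix u1
    rw [h1] at hr
    simpa using hr
  set α := (W v)⁻¹ s with hα
  set β := (W v)⁻¹ (s + 1) with hβ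
  set y := W (u2 ++ v) with hyd
  set x := W (u2 ++ s :: v) with hxd
  set r := Equiv.swap α β with hrd
  have hvα : W v α = s := by simp [hα]
  have hvβ : W v β = s + 1 := by simp [hβ]
  have hvr : sT s * W v = W v * r := by
    rw [hrd, Equiv.mul_swap_eq_swap_mul]; simp [sT, hvα, hvβ]
  have hxy : x = y * r := by
    rw [hxd, hyd, W_append, W_append, W_cons, hvr, mul_assoc]
  set P := y⁻¹ t with hP
  set Q := y⁻¹ (t + 1) with hQ
  have hPQ : P < Q := hy.2
  have yP : y P = t := by simp [hP]
  have yQ : y Q = t + 1 := by simp [hQ]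
  have hrr : r⁻¹ = r := by simp [hrd]
  have hx : r Q < r P := by
    have h4 : ¬ x⁻¹ t < x⁻¹ (t + 1) := fun h => h3 ⟨h2, h⟩
    have h5 : x⁻¹ t ≠ x⁻¹ (t + 1) := fun h => by have := x⁻¹.injective h; omega
    rw [hxy, mul_inv_rev, hrr, Equiv.Perm.mul_apply, Equiv.Perm.mul_apply] at h4 h5
    change ¬ r P < r Q at h4
    change r P ≠ r Q at h5
    omega
  -- `α`, `β` are inverted in `x`
  have h6 : y α < y β := by
    have := inv_mono u2 (s :: v) h2 α β hs (by
      simp [W_cons, hvα, hvβ, sT_apply])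
    rw [← hxd, hxy] at this
    simpa [hrd] using this
  have mono : ∀ a b, a < b → W v b < W v a → y b < y a := fun a b hab h =>
    inv_mono u2 v hy.1 a b hab h
  have vinj : ∀ a b, W v a = W v b → a = b := fun a b h => (W v).injective h
  have yinj : ∀ a b, y a = y b → a = b := fun a b h => y.injective h
  have res : P = α ∧ Q = β := by
    simp only [hrd, Equiv.swap_apply_def] at hx
    by_cases c1 : P = α
    · by_cases c2 : Q = β
      · exact ⟨c1, c2⟩
      · exfalso
        have hQβ : Q < β := by grind
        have : ¬ W v Q < W v P := fun h => by have := mono _ _ hPQ h; omega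
        have h7 : W v Q ≠ s := fun h => by have := vinj Q α (by omega); omega
        have h8 : W v Q ≠ s + 1 := fun h => c2 (vinj Q β (by omega))
        rw [c1, hvα] at this
        have := mono Q β hQβ (by omega)
        rw [c1] at yP
        omega
    · by_cases c2 : Q = β
      · exfalso
        have hQβ : α < P := by grind
        have : ¬ W v Q < W v P := fun h => by have := mono _ _ hPQ h; omega
        have h7 : W v P ≠ s := fun h => c1 (vinj P α (by omega))
        have h8 : W v P ≠ s + 1 := fun h => by have := vinj P β (by omega); omega
        rw [c2, hvβ] at this
        have := mono α P hQβ (by omega)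
        rw [c2] at yQ
        omega
      · exfalso; grind
  refine ⟨?_, res.1, res.2⟩
  rw [hxy, hrd, ← res.1, ← res.2, Equiv.mul_swap_eq_swap_mul, yP, yQ, sT]

/-- Strict version of the reading order. -/
def aft (p q : ℤ × ℤ) : Prop := q.2 < p.2 ∨ (p.2 = q.2 ∧ p.1 < q.1)

/-- The letter of a position. -/
def ltr (n : ℤ) (p : ℤ × ℤ) : ℤ := p.1 + p.2 - n - 1

lemma sort_aft (S : Finset (ℤ × ℤ)) : (S.sort rcOrder).Pairwise aft := by
  have h1 := Finset.pairwise_sort S rcOrder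
  have h2 := Finset.sort_nodup S rcOrder
  refine (h1.and h2).imp ?_
  rintro ⟨a, b⟩ ⟨c, d⟩ ⟨h3, h4⟩
  simp only [rcOrder, aft, ne_eq, Prod.mk.injEq] at *
  omega

lemma aft_nodup (l : List (ℤ × ℤ)) (h : l.Pairwise aft) : l.Nodup := by
  refine h.imp ?_
  rintro ⟨a, b⟩ ⟨c, d⟩ h
  simp only [aft, ne_eq, Prod.mk.injEq] at *
  omega

lemma sort_unique (S : Finset (ℤ × ℤ)) (l : List (ℤ × ℤ)) (h : l.Pairwise aft)
    (hm : ∀ x, x ∈ l ↔ x ∈ S) : S.sort rcOrder = l := by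
  apply List.Perm.eq_of_pairwise (le := aft) ?_ (sort_aft S) h
  · rw [List.perm_ext_iff_of_nodup (Finset.sort_nodup _ _) (aft_nodup l h)]
    intro a; rw [hm]; simp
  · rintro ⟨a, b⟩ ⟨c, d⟩ _ _ h3 h4
    simp only [aft, Prod.mk.injEq] at *
    omega

/-- The permutation of a list of positions. -/
def wl (n : ℤ) (l : List (ℤ × ℤ)) : Equiv.Perm ℤ := W (l.map (ltr n))

lemma wR_eq (n : ℤ) (S : Finset (ℤ × ℤ)) : wR n S = wl n (S.sort rcOrder) := by
  simp only [wR, wl, W, List.map_map]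
  rfl

lemma sort_union (A B : Finset (ℤ × ℤ)) (h : ∀ a ∈ A, ∀ b ∈ B, aft a b) :
    (A ∪ B).sort rcOrder = A.sort rcOrder ++ B.sort rcOrder := by
  apply sort_unique
  · rw [List.pairwise_append]
    exact ⟨sort_aft A, sort_aft B, by simpa using h⟩
  · intro x; simp

lemma wR_union (n : ℤ) (A B : Finset (ℤ × ℤ)) (h : ∀ a ∈ A, ∀ b ∈ B, aft a b) :
    wR n (A ∪ B) = wR n A * wR n B := by
  rw [wR_eq, wR_eq, wR_eq, sort_union A B h]
  simp [wl, W_append]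

lemma W_fix (l : List ℤ) (y : ℤ) (h : ∀ j ∈ l, y ≠ j ∧ y ≠ j + 1) : W l y = y := by
  induction l with
  | nil => rfl
  | cons j v ih =>
    rw [W_cons, Equiv.Perm.mul_apply, ih (fun j hj => h j (by simp [hj])), sT_apply]
    have := h j (by simp)
    simp [this]

lemma W_fix_inv (l : List ℤ) (y : ℤ) (h : ∀ j ∈ l, y ≠ j ∧ y ≠ j + 1) : (W l)⁻¹ y = y := by
  rw [Equiv.Perm.inv_eq_iff_eq, W_fix l y h]

lemma wR_fix_inv (n : ℤ) (A : Finset (ℤ × ℤ)) (y : ℤ)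
    (h : ∀ p ∈ A, y ≠ ltr n p ∧ y ≠ ltr n p + 1) : (wR n A)⁻¹ y = y := by
  rw [wR_eq]
  apply W_fix_inv
  intro j hj
  simp only [List.mem_map, Finset.mem_sort] at hj
  obtain ⟨p, hp, rfl⟩ := hj
  exact h p hp

lemma wR_singleton (n : ℤ) (p : ℤ × ℤ) : wR n {p} = sT (ltr n p) := by
  rw [wR_eq]; simp [wl, W]

/-- Labels of the wiring diagram in terms of the permutation of the later crossings. -/
lemma lab_eq (n : ℤ) (S : Finset (ℤ × ℤ)) (hg : ∀ p ∈ S, p.1 ≤ n ∧ p.2 ≤ n)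
    (h1 : ∀ p ∈ S, 1 ≤ p.2) (b : Bool) (i k : ℤ) (hi : i ≤ n) :
    lab n S b i k = (wR n (S.filter (aft (i, k))))⁻¹ (i + k - n - 1 + if b then 1 else 0) := by
  fun_induction lab n S b i k with
  | case1 i k h =>
    have : i = n := by omega
    subst this
    rw [wR_fix_inv]
    · simp
    · intro p hp
      simp only [Finset.mem_filter, aft] at hp
      have := hg p hp.1
      simp only [ltr, if_true]
      omega
  | case2 i k h hm ih =>
    rw [ih (by omega)]
    have e : S.filter (aft (i, k)) = {(i + 1, k)} ∪ S.filter (aft (i + 1, k)) := by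
      ext ⟨x, y⟩
      by_cases hxy : x = i + 1 ∧ y = k
      · obtain ⟨rfl, rfl⟩ := hxy
        simp [hm, aft]
      · simp only [Finset.mem_filter, Finset.mem_union, Finset.mem_singleton, aft, Prod.mk.injEq,
          hxy, false_or]
        refine and_congr_right fun _ => ?_
        omega
    rw [e, wR_union, wR_singleton, mul_inv_rev, Equiv.Perm.mul_apply, sT_inv, sT_apply]
    · congr 1
      simp only [ltr]
      simp only [if_true, Bool.false_eq_true, if_false, add_zero]
      split_ifs <;> omega
    · simp
  | case3 i k h hm ih =>
    rw [ih (by omega)]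
    have e : S.filter (aft (i, k)) = S.filter (aft (i + 1, k)) := by
      ext ⟨x, y⟩
      by_cases hxy : x = i + 1 ∧ y = k
      · obtain ⟨rfl, rfl⟩ := hxy
        simp [hm]
      · simp only [Finset.mem_filter, aft]
        refine and_congr_right fun _ => ?_
        omega
    rw [e]
    congr 1
    simp; ring
  | case4 i k h =>
    rw [wR_fix_inv]
    · simp
    · intro p hp
      simp only [Finset.mem_filter, aft] at hp
      have := hg p hp.1
      have := h1 p hp.1
      simp only [ltr]
      simp
      omega
  | case5 i k h hm ih =>
    rw [ih (by omega)]
    have e : S.filter (aft (i, k)) =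
        S.filter (fun p => aft (i, k) p ∧ aft p (i, k - 1)) ∪
          ({(i, k - 1)} ∪ S.filter (aft (i, k - 1))) := by
      ext ⟨x, y⟩
      by_cases hxy : x = i ∧ y = k - 1
      · obtain ⟨rfl, rfl⟩ := hxy
        simp [hm, aft]
      · simp only [Finset.mem_filter, Finset.mem_union, Finset.mem_singleton, Prod.mk.injEq,
          hxy, false_or, ← and_or_left]
        simp only [aft]
        refine and_congr_right fun _ => ?_
        omega
    rw [e, wR_union, wR_union, wR_singleton, mul_inv_rev, mul_inv_rev, Equiv.Perm.mul_apply,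
      wR_fix_inv n (S.filter (fun p => aft (i, k) p ∧ aft p (i, k - 1))), Equiv.Perm.mul_apply, sT_inv, sT_apply]
    · congr 1
      simp only [ltr]
      simp only [if_true, Bool.false_eq_true, if_false, add_zero]
      split_ifs <;> omega
    · rintro ⟨x, y⟩ hp
      simp only [Finset.mem_filter] at hp
      simp only [aft] at hp
      simp only [ltr]
      simp
      omega
    · simp
    · rintro ⟨x, y⟩ hp ⟨z, w⟩ hq
      simp only [Finset.mem_filter, Finset.mem_union, Finset.mem_singleton,
        Prod.mk.injEq] at hp hq
      simp only [aft] at *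
      omega
  | case6 i k h hm ih =>
    rw [ih (by omega)]
    have e : S.filter (aft (i, k)) =
        S.filter (fun p => aft (i, k) p ∧ aft p (i, k - 1)) ∪ S.filter (aft (i, k - 1)) := by
      ext ⟨x, y⟩
      by_cases hxy : x = i ∧ y = k - 1
      · obtain ⟨rfl, rfl⟩ := hxy
        simp [hm]
      · simp only [Finset.mem_filter, Finset.mem_union, ← and_or_left]
        simp only [aft]
        refine and_congr_right fun _ => ?_
        omega
    rw [e, wR_union, mul_inv_rev, Equiv.Perm.mul_apply,
      wR_fix_inv n (S.filter (fun p => aft (i, k) p ∧ aft p (i, k - 1)))]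
    · congr 1
      simp; ring
    · rintro ⟨x, y⟩ hp
      simp only [Finset.mem_filter] at hp
      simp only [aft] at hp
      simp only [ltr]
      simp
      omega
    · rintro ⟨x, y⟩ hp ⟨z, w⟩ hq
      simp only [Finset.mem_filter] at hp hq
      simp only [aft] at *
      omega

lemma lab_split (n : ℤ) (S : Finset (ℤ × ℤ)) (hg : ∀ p ∈ S, p.1 ≤ n ∧ p.2 ≤ n)
    (h1 : ∀ p ∈ S, 1 ≤ p.2) (z : ℤ × ℤ) (hz : z.1 ≤ n) (e f : List (ℤ × ℤ))
    (hs : S.sort rcOrder = e ++ f) (he : ∀ x ∈ e, ¬ aft z x) (hf : ∀ x ∈ f, aft z x) :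
    lab n S false z.1 z.2 = (wl n f)⁻¹ (ltr n z) ∧
      lab n S true z.1 z.2 = (wl n f)⁻¹ (ltr n z + 1) := by
  have h2 : (S.filter (aft z)).sort rcOrder = f := by
    apply sort_unique
    · have := sort_aft S
      rw [hs, List.pairwise_append] at this
      exact this.2.1
    · intro x
      rw [Finset.mem_filter, ← Finset.mem_sort rcOrder, hs, List.mem_append]
      have a1 := he x
      have a2 := hf x
      tauto
  have h3 : ((z.1, z.2) : ℤ × ℤ) = z := rfl
  constructor
  · rw [lab_eq n S hg h1 _ _ _ hz, h3, wR_eq, h2]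
    simp [ltr]
  · rw [lab_eq n S hg h1 _ _ _ hz, h3, wR_eq, h2]
    simp [ltr]

/-- rc-graphs with all crossings in positive rows. -/
def Good (n : ℤ) (S : Finset (ℤ × ℤ)) : Prop :=
  (∀ p ∈ S, p.1 ≤ n ∧ p.2 ≤ n) ∧ (∀ p ∈ S, 1 ≤ p.2) ∧ Red ((S.sort rcOrder).map (ltr n))

lemma isRC_iff (n : ℤ) (S : Finset (ℤ × ℤ)) :
    IsRC n S ↔ (∀ p ∈ S, p.1 ≤ n ∧ p.2 ≤ n) ∧ Red ((S.sort rcOrder).map (ltr n)) := by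
  rw [IsRC, red_iff, wR_eq, wl]
  simp

lemma good_of_star (n : ℤ) (S : Finset (ℤ × ℤ)) (h : IsRC n S) (hs : Star n S) : Good n S := by
  rw [isRC_iff] at h
  refine ⟨h.1, ?_, h.2⟩
  have h2 := sort_aft S
  intro p hp
  have hp' : p ∈ S.sort rcOrder := by simpa using hp
  rcases List.eq_nil_or_concat (S.sort rcOrder) with h3 | ⟨l, q, h3⟩
  · simp [h3] at hp'
  · rw [List.concat_eq_append] at h3
    have hq : q ∈ S := by rw [← Finset.mem_sort rcOrder, h3]; simp
    have hpq : q.2 ≤ p.2 := by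
      rw [h3, List.mem_append] at hp'
      rcases hp' with hp' | hp'
      · rw [h3, List.pairwise_append] at h2
        have := h2.2.2 p hp' q (by simp)
        unfold aft at this
        omega
      · simp at hp'; rw [hp']
    have h4 := h.2
    rw [h3, List.map_append] at h4
    have h5 := inv_mono _ _ h4 (ltr n q) (ltr n q + 1) (by omega) (by
      simp [W, sT_apply])
    rw [← List.map_append, ← h3] at h5
    change wl n _ _ < wl n _ _ at h5
    rw [← wR_eq] at h5
    have h6 := hs (ltr n q + 1)
    rw [add_sub_cancel_right] at h6
    have := h.1 q hq
    by_contra hc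
    have := h6 (by unfold ltr; omega)
    omega

lemma not_aft_of_aft {a b : ℤ × ℤ} (h : aft a b) : ¬ aft b a := by
  unfold aft at *; omega

lemma step (n : ℤ) (S : Finset (ℤ × ℤ)) (hS : Good n S) (p : ℤ × ℤ) (hp1 : 1 ≤ p.2)
    (hpn : p.2 ≤ n) (hop : OpenSpace n S p.1 p.2) (hrc : ¬ IsRC n (insert p S)) :
    ∃ q, ((insert p S).filter fun q =>
        q ≠ p ∧ ((lab n (insert p S) true q.1 q.2 = lab n (insert p S) true p.1 p.2 ∧
            lab n (insert p S) false q.1 q.2 = lab n (insert p S) false p.1 p.2) ∨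
          (lab n (insert p S) true q.1 q.2 = lab n (insert p S) false p.1 p.2 ∧
            lab n (insert p S) false q.1 q.2 = lab n (insert p S) true p.1 p.2))) = {q} ∧
      q ∈ S ∧ p.2 < q.2 ∧ Good n ((insert p S).erase q) ∧
      lab n ((insert p S).erase q) true q.1 q.2 ≤ 0 := by
  obtain ⟨hg, h1, hred⟩ := hS
  obtain ⟨hpi, hpS, hlf, hlt⟩ := hop
  have hpS : p ∉ S := hpS
  set T := insert p S with hT
  have hgT : ∀ p ∈ T, p.1 ≤ n ∧ p.2 ≤ n := by
    intro x hx
    rcases Finset.mem_insert.1 hx with rfl | hx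
    · exact ⟨hpi, hpn⟩
    · exact hg x hx
  have h1T : ∀ p ∈ T, 1 ≤ p.2 := by
    intro x hx
    rcases Finset.mem_insert.1 hx with rfl | hx
    · exact hp1
    · exact h1 x hx
  set U := (S.filter (fun x => aft x p)).sort rcOrder with hU
  set V := (S.filter (aft p)).sort rcOrder with hV
  have hUm : ∀ x ∈ U, aft x p := by intro x hx; simp [hU] at hx; exact hx.2
  have hVm : ∀ x ∈ V, aft p x := by intro x hx; simp [hV] at hx; exact hx.2
  have tot : ∀ x, x ≠ p → aft x p ∨ aft p x := by
    rintro ⟨a, b⟩ h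
    have : a ≠ p.1 ∨ b ≠ p.2 := by
      by_contra hc; push Not at hc; exact h (Prod.ext hc.1 hc.2)
    simp only [aft]; omega
  have atr : ∀ a b c, aft a b → aft b c → aft a c := by
    intro a b c; unfold aft; omega
  have hSU : S.sort rcOrder = U ++ V := by
    rw [hU, hV, ← sort_union]
    · congr 1
      ext x
      simp only [Finset.mem_union, Finset.mem_filter, ← and_or_left]
      refine ⟨fun h => ⟨h, tot x ?_⟩, fun h => h.1⟩
      rintro rfl; exact hpS h
    · intro a ha b hb
      exact atr _ _ _ (Finset.mem_filter.1 ha).2 (Finset.mem_filter.1 hb).2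
  have hTU : T.sort rcOrder = U ++ p :: V := by
    apply sort_unique
    · have := sort_aft S
      rw [hSU, List.pairwise_append] at this
      rw [List.pairwise_append, List.pairwise_cons]
      refine ⟨this.1, ⟨hVm, this.2.1⟩, ?_⟩
      intro a ha b hb
      rcases List.mem_cons.1 hb with rfl | hb
      · exact hUm a ha
      · exact this.2.2 a ha b hb
    · intro x
      rw [hT, Finset.mem_insert, ← Finset.mem_sort rcOrder, hSU]
      simp only [List.mem_append, List.mem_cons]
      tauto
  have hlS := lab_split n S hg h1 p hpi U V hSU (fun x hx => not_aft_of_aft (hUm x hx)) hVm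
  have nself : ¬ aft p p := by unfold aft; omega
  have hlT := lab_split n T hgT h1T p hpi (U ++ [p]) V (by simp [hTU]) (by
    intro x hx
    rcases List.mem_append.1 hx with hx | hx
    · exact not_aft_of_aft (hUm x hx)
    · rw [List.mem_singleton.1 hx]; exact nself) hVm
  rw [hlS.1] at hlf
  rw [hlS.2] at hlt
  rw [hlT.1, hlT.2]
  rw [isRC_iff, hTU] at hrc
  have hnr : ¬ Red (U.map (ltr n) ++ ltr n p :: V.map (ltr n)) := fun h =>
    hrc ⟨hgT, by simpa using h⟩
  rw [hSU, List.map_append] at hred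
  obtain ⟨u1, t, u2, k1, k2, k3, k4, k5⟩ := key _ _ _ hred (by
    change (wl n V)⁻¹ _ < (wl n V)⁻¹ _
    omega) hnr
  rw [List.map_eq_append_iff] at k1
  obtain ⟨U1, U', hUU, rfl, k1⟩ := k1
  rw [List.map_eq_cons_iff] at k1
  obtain ⟨q, U2, rfl, rfl, rfl⟩ := k1
  set s := ltr n p with hs
  set v := V.map (ltr n) with hv
  set t := ltr n q with ht
  set u1 := U1.map (ltr n) with hu1
  set u2 := U2.map (ltr n) with hu2
  have hVv : wl n V = W v := rfl
  rw [hVv] at *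
  set α := (W v)⁻¹ s with hα
  set β := (W v)⁻¹ (s + 1) with hβ
  set y := W (u2 ++ v) with hy
  set x := W (u2 ++ s :: v) with hx
  have yα : y α = t := by rw [← k4]; simp
  have yβ : y β = t + 1 := by rw [← k5]; simp
  have xα : x α = t + 1 := by rw [← k3, Equiv.Perm.mul_apply, yα]; simp [sT_apply]
  have xβ : x β = t := by rw [← k3, Equiv.Perm.mul_apply, yβ]; simp [sT_apply]
  have xit : x⁻¹ t = β := by rw [← xβ]; simp
  have xit' : x⁻¹ (t + 1) = α := by rw [← xα]; simp
  have hyx : sT t * x = y := by rw [← k3, ← mul_assoc, sT_mul_self, one_mul]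
  have hyr : y = x * Equiv.swap α β := by
    rw [Equiv.mul_swap_eq_swap_mul, xα, xβ, ← hyx, Equiv.swap_comm]; rfl
  have hTl : T.sort rcOrder = U1 ++ q :: (U2 ++ p :: V) := by rw [hTU, hUU]; simp
  have hTpw := sort_aft T
  rw [hTl] at hTpw
  have hpw := hTpw
  rw [List.pairwise_append, List.pairwise_cons] at hpw
  obtain ⟨pw1, ⟨pw2, pw3⟩, pw4⟩ := hpw
  have hqU : q ∈ U := by rw [hUU]; simp
  have hqp : aft q p := hUm q hqU
  have hqS : q ∈ S := by rw [← Finset.mem_sort rcOrder, hSU]; simp [hqU]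
  have hqT : q ∈ T := Finset.mem_insert_of_mem hqS
  have hqne : q ≠ p := by rintro rfl; exact hpS hqS
  -- the erased diagram
  set R' := T.erase q with hR'
  have hRl : R'.sort rcOrder = U1 ++ (U2 ++ p :: V) := by
    apply sort_unique
    · rw [List.pairwise_append]
      exact ⟨pw1, pw3, fun a ha b hb => pw4 a ha b (List.mem_cons_of_mem _ hb)⟩
    · intro z
      have nd := aft_nodup _ hTpw
      rw [hR', Finset.mem_erase, ← Finset.mem_sort rcOrder, hTl]
      rw [List.nodup_middle, List.nodup_cons] at nd
      constructor
      · intro hz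
        refine ⟨fun h => nd.1 (h ▸ hz), ?_⟩
        simp only [List.mem_append, List.mem_cons] at hz ⊢
        tauto
      · rintro ⟨h1, h2⟩
        simp only [List.mem_append, List.mem_cons] at h2 ⊢
        tauto
  have hgR : ∀ p ∈ R', p.1 ≤ n ∧ p.2 ≤ n := fun z hz => hgT z (Finset.mem_of_mem_erase hz)
  have h1R : ∀ p ∈ R', 1 ≤ p.2 := fun z hz => h1T z (Finset.mem_of_mem_erase hz)
  have hRred : Red (u1 ++ (u2 ++ s :: v)) := by
    have hUm : U.map (ltr n) = u1 ++ t :: u2 := by rw [hUU]; simp [hu1, hu2, ht]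
    have e1 : W (u1 ++ (u2 ++ s :: v)) = W (U.map (ltr n) ++ v) := by
      rw [W_append, ← hx, ← k3, hUm, List.append_assoc, List.cons_append, W_append, W_cons]
    rw [red_iff, e1, red_len _ hred, hUm]
    simp; omega
  have nselfq : ¬ aft q q := by unfold aft; omega
  have hlq := lab_split n T hgT h1T q (hg q hqS).1 (U1 ++ [q]) (U2 ++ p :: V) (by simp [hTl]) (by
    intro z hz
    rcases List.mem_append.1 hz with hz | hz
    · exact not_aft_of_aft (pw4 z hz q (by simp))
    · rw [List.mem_singleton.1 hz]; exact nselfq) pw2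
  have hlqR := lab_split n R' hgR h1R q (hg q hqS).1 U1 (U2 ++ p :: V) hRl (by
    intro z hz
    exact not_aft_of_aft (pw4 z hz q (by simp))) pw2
  have hwx : wl n (U2 ++ p :: V) = x := by simp [wl, hx, hu2, hs, hv]
  rw [hwx, ← ht, xit, xit'] at hlq hlqR
  refine ⟨q, ?_, hqS, ?_, ⟨hgR, h1R, ?_⟩, ?_⟩
  · ext z
    rw [Finset.mem_filter, Finset.mem_singleton]
    constructor
    · rintro ⟨hzT, hzp, hz⟩
      by_contra hzq
      have hzl : z ∈ U1 ++ q :: (U2 ++ p :: V) := by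
        rw [← hTl]; simpa using hzT
      have labz : ∀ e f, U1 ++ q :: (U2 ++ p :: V) = e ++ z :: f →
          lab n T false z.1 z.2 = (wl n f)⁻¹ (ltr n z) ∧
          lab n T true z.1 z.2 = (wl n f)⁻¹ (ltr n z + 1) := by
        intro e f hef
        have pz := hTpw
        rw [hef, List.pairwise_append, List.pairwise_cons] at pz
        apply lab_split n T hgT h1T z (hgT z hzT).1 (e ++ [z]) f (by rw [hTl, hef]; simp)
        · intro c hc
          rcases List.mem_append.1 hc with hc | hc
          · exact not_aft_of_aft (pz.2.2 c hc z (by simp))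
          · rw [List.mem_singleton.1 hc]; unfold aft; omega
        · exact pz.2.1.1
      simp only [List.mem_append, List.mem_cons, hzq, hzp, false_or] at hzl
      rcases hzl with hzl | hzl | hzl
      · obtain ⟨g, h, hgh⟩ := List.append_of_mem hzl
        obtain ⟨l1, l2⟩ := labz g (h ++ q :: (U2 ++ p :: V)) (by rw [hgh]; simp)
        have hw : wl n (h ++ q :: (U2 ++ p :: V)) = W (h.map (ltr n)) * y := by
          rw [← hyx, hx, ← W_cons, ← W_append]
          simp [wl, hu2, hv, hs, ht]
        rw [l1, l2, hw, hyr, ← mul_assoc, mul_inv_rev, Equiv.Perm.mul_apply,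
          Equiv.Perm.mul_apply, hx, ← W_append, Equiv.swap_inv] at hz
        rw [hu1, hgh, List.map_append, List.map_cons, List.append_assoc, List.cons_append,
          ← List.append_assoc (List.map (ltr n) h)] at hRred
        apply cross_unique _ _ _ _ _ hRred
        rw [List.append_assoc, ← hα, ← hβ]
        have sw : ∀ c d, Equiv.swap α β c = d → c = Equiv.swap α β d := by
          intro c d h; rw [← h]; simp
        rcases hz with ⟨a, b⟩ | ⟨a, b⟩
        · right
          have a := sw _ _ a
          have b := sw _ _ b
          simp only [Equiv.swap_apply_left, Equiv.swap_apply_right] at a b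
          exact ⟨b, a⟩
        · left
          have a := sw _ _ a
          have b := sw _ _ b
          simp only [Equiv.swap_apply_left, Equiv.swap_apply_right] at a b
          exact ⟨b, a⟩
      · obtain ⟨g, h, hgh⟩ := List.append_of_mem hzl
        obtain ⟨l1, l2⟩ := labz (U1 ++ q :: g) (h ++ p :: V) (by rw [hgh]; simp)
        have hw : wl n (h ++ p :: V) = W (h.map (ltr n) ++ s :: v) := by
          simp [wl, hv, hs]
        rw [l1, l2, hw] at hz
        rw [hu2, hgh, List.map_append, List.map_cons, List.append_assoc, List.cons_append] at k2
        apply cross_unique _ _ _ _ _ k2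
        tauto
      · obtain ⟨g, h, hgh⟩ := List.append_of_mem hzl
        obtain ⟨l1, l2⟩ := labz (U1 ++ q :: (U2 ++ p :: g)) h (by rw [hgh]; simp)
        rw [l1, l2] at hz
        have hvv : v = g.map (ltr n) ++ ltr n z :: h.map (ltr n) := by rw [hv, hgh]; simp
        rw [hα, hβ, hvv] at hz
        rw [hvv] at k2
        apply cross_unique _ _ _ _ _ k2
        change ((wl n h)⁻¹ _ = _ ∧ _) ∨ _ at hz
        change (_ = (wl n h)⁻¹ _ ∧ _ = (wl n h)⁻¹ _) ∨ (_ = (wl n h)⁻¹ _ ∧ _ = (wl n h)⁻¹ _)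
        rcases hz with ⟨a, b⟩ | ⟨a, b⟩
        · left; exact ⟨b.symm, a.symm⟩
        · right; exact ⟨a.symm, b.symm⟩
    · rintro rfl
      refine ⟨hqT, hqne, Or.inr ⟨hlq.2, hlq.1⟩⟩
  · by_contra hrow
    have hrow' : q.2 = p.2 ∧ q.1 < p.1 := by unfold aft at hqp; omega
    have : x α = s + 1 := by
      rw [hx, W_append, W_cons, Equiv.Perm.mul_apply, Equiv.Perm.mul_apply,
        show W v α = s by simp [hα], sT_apply, if_pos rfl]
      apply W_fix
      intro j hj
      simp only [hu2, List.mem_map] at hj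
      obtain ⟨c, hc, rfl⟩ := hj
      have c1 := pw2 c (by simp [hc])
      have c2 := hUm c (by rw [hUU]; simp [hc])
      simp only [aft, ltr, hs] at *
      omega
    rw [xα] at this
    simp only [hs, ht, ltr] at this
    omega
  · rw [hRl]
    simpa [hu1, hu2, hs, hv] using hRred
  · rw [hlqR.2]; exact hlf

lemma lab_true_step (n : ℤ) (S : Finset (ℤ × ℤ)) (x k : ℤ) (hx : x ≤ n) :
    lab n S true (x - 1) k = if (x, k) ∈ S then lab n S true x k else lab n S false x k := by
  rw [lab]
  simp [show ¬ n ≤ x - 1 by omega]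

/-- Existence of open spaces. -/
lemma exists_open (n : ℤ) (S : Finset (ℤ × ℤ)) (l k : ℤ) (hl : l ≤ n) (hk : 1 ≤ k)
    (h : lab n S true l k ≤ 0) : ∃ x, l < x ∧ OpenSpace n S x k := by
  obtain ⟨d, hd⟩ : ∃ d : ℕ, l = n - d := ⟨(n - l).toNat, by omega⟩
  induction d generalizing l with
  | zero =>
    have : l = n := by simpa using hd
    subst this
    rw [lab] at h
    simp at h
    omega
  | succ d ih =>
    have h2 := lab_true_step n S (l + 1) k (by push_cast at hd; omega)
    rw [add_sub_cancel_right] at h2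
    by_cases h3 : lab n S true (l + 1) k ≤ 0
    · obtain ⟨x, hx, hx'⟩ := ih (l + 1) (by push_cast at hd; omega) h3
        (by push_cast at hd; omega)
      exact ⟨x, by omega, hx'⟩
    · refine ⟨l + 1, by omega, by push_cast at hd; omega, ?_⟩
      split_ifs at h2 with h4
      · omega
      · exact ⟨h4, by omega, by omega⟩

lemma lab_right (n : ℤ) (S : Finset (ℤ × ℤ)) (hS : Good n S) (k : ℤ) :
    ∃ N, N ≤ n ∧ ∀ x ≤ N, lab n S true x k ≤ 0 := by
  obtain ⟨M, hM⟩ : ∃ M, ∀ p ∈ S, M ≤ ltr n p := by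
    obtain ⟨M, hM⟩ := (S.image (ltr n)).bddBelow
    exact ⟨M, fun p hp => hM (by simpa using ⟨p.1, p.2, hp, rfl⟩)⟩
  refine ⟨min n (min (n - k) (M - 1 - k + n)), by omega, fun x hx => ?_⟩
  rw [lab_eq n S hS.1 hS.2.1 true x k (by omega), wR_fix_inv]
  · simp; omega
  · intro p hp
    have := hM p (Finset.mem_filter.1 hp).1
    simp
    omega

/-- The loop invariant. -/
lemma loop (n : ℤ) (fuel : ℕ) (S : Finset (ℤ × ℤ)) (hS : Good n S) (p : ℤ × ℤ) (hp1 : 1 ≤ p.2)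
    (hpn : p.2 ≤ n) (hop : OpenSpace n S p.1 p.2) (hf : n + 1 - p.2 ≤ fuel)
    (d : Finset (ℤ × ℤ) × (ℤ × ℤ)) :
    ∃ G, ((insertSteps n fuel (insert p S) p).getLast?.getD d).1 = G ∧ IsRC n G ∧
      G.val.map Prod.snd = p.2 ::ₘ S.val.map Prod.snd := by
  induction fuel generalizing S p d with
  | zero => push_cast at hf; omega
  | succ fuel ih =>
    have hpS : p ∉ S := hop.2.1
    have hval : ∀ (S : Finset (ℤ × ℤ)) (p : ℤ × ℤ), p ∉ S →
        (insert p S).val.map Prod.snd = p.2 ::ₘ S.val.map Prod.snd := by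
      intro S p h
      rw [Finset.insert_val_of_notMem h, Multiset.map_cons]
    rw [insertSteps]
    by_cases hrc : IsRC n (insert p S)
    · refine ⟨insert p S, by simp [hrc], hrc, hval S p hpS⟩
    · obtain ⟨q, hC, hqS, hrow, hG, hlab⟩ := step n S hS p hp1 hpn hop hrc
      simp only [hrc, if_false]
      rw [hC]
      simp only [Finset.sort_singleton, List.headI]
      set R' := (insert p S).erase q with hR'
      have hqT : q ∈ insert p S := Finset.mem_insert_of_mem hqS
      set X := {x : ℤ | q.1 < x ∧ OpenSpace n R' x q.2} with hX
      have hq := hS.1 q hqS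
      have hq1 := hS.2.1 q hqS
      have hmem : sInf X ∈ X := Int.csInf_mem (exists_open n R' q.1 q.2 hq.1 hq1 hlab)
        ⟨q.1, fun x hx => hx.1.le⟩
      obtain ⟨G, g1, g2, g3⟩ := ih R' hG (sInf X, q.2) hq1 hq.2 hmem.2 (by
        push_cast at hf; simp only; omega) (insert p S, p)
      refine ⟨G, ?_, g2, ?_⟩
      · rw [List.getLast?_cons]
        exact g1
      · rw [g3, ← hval S p hpS, hR', ← Finset.insert_erase hqT, hval _ q (by simp)]
        simp

/-- For an rc-graph `R` satisfying (*) and `1 ≤ k ≤ n`, the insertion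
`R ← k` is again an rc-graph; it has the same number of crossings as `R` in every row
except row `k`, where it has exactly one more crossing; consequently
`x^{R←k} = x^R · x_k`. -/
theorem insertOne_isRC (n : ℕ) (hn : 0 < n) (R : Finset (ℤ × ℤ))
    (hR : IsRC n R) (hS : Star n R) (k : ℤ) (hk1 : 1 ≤ k) (hkn : k ≤ n) :
    IsRC n (insertOne n R k) ∧
    (∀ r : ℤ, r ≠ k →
      ((insertOne n R k).filter fun p => p.2 = r).card = (R.filter fun p => p.2 = r).card) ∧
    ((insertOne n R k).filter fun p => p.2 = k).card
      = (R.filter fun p => p.2 = k).card + 1 ∧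
    xR (insertOne n R k) = xR R * MvPolynomial.X k.toNat := by
  obtain ⟨N, hNn, hN⟩ := lab_right n R (good_of_star n R hR hS) k
  have hgood := good_of_star n R hR hS
  have hmem : sInf {x : ℤ | OpenSpace n R x k} ∈ {x : ℤ | OpenSpace n R x k} := by
    apply Int.csInf_mem
    · obtain ⟨x, _, hx⟩ := exists_open n R N k hNn hk1 (hN N le_rfl)
      exact ⟨x, hx⟩
    · refine ⟨N, fun x hx => ?_⟩
      by_contra hc
      have := hN x (by omega)
      have := hx.2.2.2
      omega
  obtain ⟨G, g1, g2, g3⟩ := loop n (((n : ℤ) + 1 - k).toNat + 1) R hgood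
    (sInf {x : ℤ | OpenSpace n R x k}, k) hk1 hkn hmem (by push_cast; omega) (R, (0, 0))
  have hG : insertOne n R k = G := g1
  rw [hG]
  have hcount : ∀ (A : Finset (ℤ × ℤ)) (r : ℤ),
      (A.filter fun p => p.2 = r).card = (A.val.map Prod.snd).count r := by
    intro A r
    rw [Multiset.count_map, Finset.card_def, Finset.filter_val]
    congr 1
    apply Multiset.filter_congr
    intro x _
    exact eq_comm
  have hprod : ∀ A : Finset (ℤ × ℤ),
      xR A = ((A.val.map Prod.snd).map fun r => MvPolynomial.X (R := ℤ) r.toNat).prod := by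
    intro A
    rw [xR, Finset.prod, Multiset.map_map]
    rfl
  refine ⟨g2, ?_, ?_, ?_⟩
  · intro r hr
    rw [hcount, hcount, g3, Multiset.count_cons_of_ne hr]
  · rw [hcount, hcount, g3, Multiset.count_cons_self]
  · rw [hprod, hprod, g3, Multiset.map_cons, Multiset.prod_cons, mul_comm]

end RCGraphs
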